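/- arXiv:2603.25182 — 2 statements merged into one kernel-verified Lean document; each statement's English description precedes it below -/
import Mathlib

section
/- Let K ⊆ H be a nonempty closed convex set and let F : H → ℝ be lower semicontinuous (for the norm topology) and λ-convex on K with λ > 0; let T* be the unique minimizer of F over K. Fix τ > 0 and T₀ ∈ K, and define the proximal iterates by letting T_{k+1} be the unique minimizer over K of T ↦ F(T) + ‖T − T_k‖²/(2τ) for each k ≥ 0. Then T_k → T* strongly in H as k → ∞, and there exists a constant C ≥ 0 such that ‖T_k − T*‖ ≤ C · α^k for all k, where α := (1 + λ²τ²/4)^{−1/2} < 1. -/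
open Filter
open scoped RealInnerProductSpace

variable {H : Type*} [NormedAddCommGroup H] [InnerProductSpace ℝ H] [CompleteSpace H]

/-- `F` is `λ`-convex on the convex set `K`. -/
def LambdaConvexOn (lam : ℝ) (K : Set H) (F : H → ℝ) : Prop :=
  ∀ T ∈ K, ∀ S ∈ K, ∀ s : ℝ, 0 ≤ s → s ≤ 1 →
    F ((1 - s) • T + s • S) ≤
      (1 - s) * F T + s * F S - lam / 2 * s * (1 - s) * ‖T - S‖ ^ 2

theorem aux_growth {H : Type*} [NormedAddCommGroup H] [InnerProductSpace ℝ H]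
    (m : ℝ) (hm : 0 < m) (K : Set H) (hK : Convex ℝ K) (G : H → ℝ)
    (hG : ∀ T ∈ K, ∀ S ∈ K, ∀ s : ℝ, 0 ≤ s → s ≤ 1 →
      G ((1 - s) • T + s • S) ≤
        (1 - s) * G T + s * G S - m / 2 * s * (1 - s) * ‖T - S‖ ^ 2)
    (a b : H) (ha : a ∈ K) (hb : b ∈ K) (hmin : ∀ U ∈ K, G a ≤ G U) :
    G a + m / 2 * ‖a - b‖ ^ 2 ≤ G b := by
  have key : ∀ s : ℝ, 0 < s → s ≤ 1 →
      (m / 2 * ‖a - b‖ ^ 2) * (1 - s) ≤ G b - G a := by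
    intro s hs hs1
    have h1 := hG a ha b hb s hs.le hs1
    have h2 := hmin _ (hK ha hb (by linarith : (0:ℝ) ≤ 1 - s) hs.le (by ring))
    have h3 : s * ((m / 2 * ‖a - b‖ ^ 2) * (1 - s)) ≤ s * (G b - G a) := by nlinarith
    exact le_of_mul_le_mul_left h3 hs
  have hB := hmin b hb
  have hA : 0 ≤ m / 2 * ‖a - b‖ ^ 2 := by positivity
  generalize m / 2 * ‖a - b‖ ^ 2 = A at *
  by_contra hlt
  have hd : 0 < A - (G b - G a) := by linarith
  have h := key ((A - (G b - G a)) / (2 * (A + 1))) (by positivity)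
    (by rw [div_le_one (by positivity)]; linarith)
  have h4 : A * ((A - (G b - G a)) / (2 * (A + 1))) ≤ (A - (G b - G a)) / 2 := by
    rw [← mul_div_assoc, div_le_div_iff₀ (by positivity) (by positivity)]
    nlinarith
  nlinarith

theorem aux_norm {H : Type*} [NormedAddCommGroup H] [InnerProductSpace ℝ H]
    (a b p : H) (s : ℝ) :
    ‖(1 - s) • a + s • b - p‖ ^ 2 =
      (1 - s) * ‖a - p‖ ^ 2 + s * ‖b - p‖ ^ 2 - s * (1 - s) * ‖a - b‖ ^ 2 := by
  have e1 : (1 - s) • a + s • b - p = (1 - s) • (a - p) + s • (b - p) := by module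
  have e2 : a - b = (a - p) - (b - p) := by abel
  rw [e1, e2, norm_add_sq_real, norm_sub_sq_real (a - p) (b - p), norm_smul, norm_smul, inner_smul_left,
    inner_smul_right, mul_pow, mul_pow, Real.norm_eq_abs, Real.norm_eq_abs, sq_abs, sq_abs]
  simp only [conj_trivial]
  ring

theorem aux_step {H : Type*} [NormedAddCommGroup H] [InnerProductSpace ℝ H]
    (lam τ : ℝ) (hlam : 0 < lam) (hτ : 0 < τ) (K : Set H) (hK : Convex ℝ K) (F : H → ℝ)
    (hF : ∀ T ∈ K, ∀ S ∈ K, ∀ s : ℝ, 0 ≤ s → s ≤ 1 →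
      F ((1 - s) • T + s • S) ≤
        (1 - s) * F T + s * F S - lam / 2 * s * (1 - s) * ‖T - S‖ ^ 2)
    (a b p : H) (ha : a ∈ K) (hb : b ∈ K) (hminb : ∀ U ∈ K, F b ≤ F U)
    (hmina : ∀ U ∈ K, F a + ‖a - p‖ ^ 2 / (2 * τ) ≤ F U + ‖U - p‖ ^ 2 / (2 * τ)) :
    (1 + lam * τ) * ‖a - b‖ ≤ ‖p - b‖ := by
  have h1 := aux_growth lam hlam K hK F hF b a hb ha hminb
  have h2 := aux_growth (lam + 1 / τ) (by positivity) K hK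
    (fun U => F U + ‖U - p‖ ^ 2 / (2 * τ)) (by
      intro T hT S hS s hs hs1
      have := hF T hT S hS s hs hs1
      simp only [aux_norm]
      have e : ((1 - s) * ‖T - p‖ ^ 2 + s * ‖S - p‖ ^ 2 - s * (1 - s) * ‖T - S‖ ^ 2) / (2 * τ)
        = (1 - s) * (‖T - p‖ ^ 2 / (2 * τ)) + s * (‖S - p‖ ^ 2 / (2 * τ))
          - (1 / τ) / 2 * s * (1 - s) * ‖T - S‖ ^ 2 := by
        field_simp
      rw [e]
      linarith) a b ha hb hmina
  rw [norm_sub_rev b a] at h1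
  rw [norm_sub_rev b p] at h2
  have h3 : ‖p - b‖ ≤ ‖a - p‖ + ‖a - b‖ := by
    rw [norm_sub_rev a p]; exact norm_sub_le_norm_sub_add_norm_sub p a b
  have h4 : (1 + 2 * (lam * τ)) * ‖a - b‖ ^ 2 + ‖a - p‖ ^ 2 ≤ ‖p - b‖ ^ 2 := by
    have h5 : lam * ‖a - b‖ ^ 2 + 1 / τ / 2 * ‖a - b‖ ^ 2 + ‖a - p‖ ^ 2 / (2 * τ)
        ≤ ‖p - b‖ ^ 2 / (2 * τ) := by linarith
    rw [le_div_iff₀ (by positivity)] at h5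
    have e : (lam * ‖a - b‖ ^ 2 + 1 / τ / 2 * ‖a - b‖ ^ 2 + ‖a - p‖ ^ 2 / (2 * τ)) * (2 * τ)
        = (1 + 2 * (lam * τ)) * ‖a - b‖ ^ 2 + ‖a - p‖ ^ 2 := by
      field_simp
      ring
    linarith
  have hx : 0 < lam * τ := by positivity
  generalize lam * τ = x at *
  have hd := norm_nonneg (a - b)
  have hD := norm_nonneg (p - b)
  have hq := norm_nonneg (a - p)
  generalize ‖a - b‖ = d at *
  generalize ‖p - b‖ = D at *
  generalize ‖a - p‖ = q at *
  have hdD : d ≤ D := by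
    refine (sq_le_sq₀ hd hD).1 ?_
    nlinarith [mul_nonneg hx.le (sq_nonneg d), sq_nonneg q]
  have hq2 : (D - d) ^ 2 ≤ q ^ 2 := pow_le_pow_left₀ (by linarith) (by linarith) 2
  rcases hd.eq_or_lt with h | h
  · rw [← h]; simpa using hD
  · have : d * ((1 + x) * d) ≤ d * D := by nlinarith
    exact le_of_mul_le_mul_left this h

/-- Strong convergence, with linear rate `α := (1 + λ²τ²/4)^{−1/2} < 1`, of the proximal
iterates of a lower semicontinuous `λ`-convex functional (`λ > 0`) to its unique minimizer
over `K`. -/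
theorem prox_iterates_strong_convergence (K : Set H) (hKne : K.Nonempty)
    (hKcl : IsClosed K) (hKconv : Convex ℝ K)
    (F : H → ℝ) (hlsc : LowerSemicontinuous F)
    (lam : ℝ) (hlam : 0 < lam) (hconv : LambdaConvexOn lam K F)
    (Tstar : H) (hTstar : Tstar ∈ K) (hmin : ∀ U ∈ K, F Tstar ≤ F U)
    (huniq : ∀ m : H, m ∈ K → (∀ U ∈ K, F m ≤ F U) → m = Tstar)
    (τ : ℝ) (hτ : 0 < τ) (T₀ : H) (hT₀ : T₀ ∈ K)
    (Tseq : ℕ → H) (h0 : Tseq 0 = T₀)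
    (hstep : ∀ k : ℕ, Tseq (k + 1) ∈ K ∧
      ∀ U ∈ K, F (Tseq (k + 1)) + ‖Tseq (k + 1) - Tseq k‖ ^ 2 / (2 * τ) ≤
        F U + ‖U - Tseq k‖ ^ 2 / (2 * τ)) :
    Tendsto Tseq atTop (nhds Tstar) ∧
    ((1 + lam ^ 2 * τ ^ 2 / 4 : ℝ) ^ (-(1 / 2) : ℝ) < 1 ∧
      ∃ C : ℝ, 0 ≤ C ∧ ∀ k : ℕ,
        ‖Tseq k - Tstar‖ ≤ C * ((1 + lam ^ 2 * τ ^ 2 / 4 : ℝ) ^ (-(1 / 2) : ℝ)) ^ k) := by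
  set α : ℝ := (1 + lam ^ 2 * τ ^ 2 / 4 : ℝ) ^ (-(1 / 2) : ℝ) with hα
  have hx : 0 < lam * τ := by positivity
  have hpos : 0 < 1 + lam ^ 2 * τ ^ 2 / 4 := by positivity
  have hα0 : 0 < α := Real.rpow_pos_of_pos hpos _
  have hα1 : α < 1 := Real.rpow_lt_one_of_one_lt_of_neg
    (by have : 0 < lam ^ 2 * τ ^ 2 / 4 := by positivity
        linarith) (by norm_num)
  have hαsq : α ^ 2 * (1 + lam ^ 2 * τ ^ 2 / 4) = 1 := by
    have : α ^ 2 = (1 + lam ^ 2 * τ ^ 2 / 4)⁻¹ := by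
      rw [hα, ← Real.rpow_natCast, ← Real.rpow_mul hpos.le]
      norm_num [Real.rpow_neg_one]
    rw [this, inv_mul_cancel₀ hpos.ne']
  have hα2 : 1 ≤ α * (1 + lam * τ) := by
    have h1 : (1:ℝ) ^ 2 ≤ (α * (1 + lam * τ)) ^ 2 := by
      have : α ^ 2 * (1 + lam ^ 2 * τ ^ 2 / 4) ≤ α ^ 2 * (1 + lam * τ) ^ 2 := by
        apply mul_le_mul_of_nonneg_left _ (sq_nonneg _)
        nlinarith
      rw [mul_pow]; linarith
    exact (sq_le_sq₀ (by norm_num) (by positivity)).1 h1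
  have step : ∀ k, ‖Tseq (k + 1) - Tstar‖ ≤ α * ‖Tseq k - Tstar‖ := by
    intro k
    have h := aux_step lam τ hlam hτ K hKconv F hconv (Tseq (k + 1)) Tstar (Tseq k)
      (hstep k).1 hTstar hmin (hstep k).2
    have h1 := mul_le_mul_of_nonneg_left h hα0.le
    nlinarith [mul_le_mul_of_nonneg_right hα2 (norm_nonneg (Tseq (k + 1) - Tstar))]
  have bound : ∀ k, ‖Tseq k - Tstar‖ ≤ ‖Tseq 0 - Tstar‖ * α ^ k := by
    intro k
    induction k with
    | zero => simp
    | succ k ih =>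
      refine (step k).trans ?_
      rw [pow_succ]
      nlinarith [mul_le_mul_of_nonneg_left ih hα0.le]
  refine ⟨?_, hα1, ‖Tseq 0 - Tstar‖, norm_nonneg _, bound⟩
  rw [tendsto_iff_norm_sub_tendsto_zero]
  refine squeeze_zero (fun _ => norm_nonneg _) bound ?_
  simpa using (tendsto_pow_atTop_nhds_zero_of_lt_one hα0.le hα1).const_mul ‖Tseq 0 - Tstar‖
end

section
/- (Lyapunov monotonicity along the constrained gradient flow.) Let K ⊆ H be a nonempty closed convex set, F : H → ℝ Fréchet differentiable with gradient ∇F, and let T* ∈ K be a minimizer of F over K. Assume F is star-convex on K around T* (i.e., 0-star-convex). Let T : [0,∞) → H be a solution of the constrained gradient flow of F in K starting at T₀ ∈ K. Then t ↦ ‖T(t) − T*‖ is nonincreasing on [0,∞). -/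
open MeasureTheory
open scoped RealInnerProductSpace

variable {H : Type*} [NormedAddCommGroup H] [InnerProductSpace ℝ H] [CompleteSpace H]

/-- The tangent cone of a convex set `K` at a point `T ∈ K`. -/
def tanCone (K : Set H) (T : H) : Set H :=
  closure {w : H | ∃ t : ℝ, 0 < t ∧ T + t • w ∈ K}

/-- `w` is the metric projection of `v` onto the set `C`. -/
def IsProjOn (C : Set H) (v w : H) : Prop :=
  w ∈ C ∧ ∀ u ∈ C, ‖v - w‖ ≤ ‖v - u‖

/-- `T : [0,∞) → H` (with a.e. derivative `T'`) is a solution of the constrained gradient flow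
of `F` (with gradient `F'`) in `K` starting at `T₀`: a locally absolutely continuous curve
(encoded by the fundamental theorem of calculus with a locally integrable a.e.-derivative)
staying in `K`, starting at `T₀`, whose derivative at a.e. `t > 0` exists and is the projection
of `−F'(T(t))` onto the tangent cone of `K` at `T(t)`. -/
def IsFlowSol (K : Set H) (F' : H → H) (T₀ : H) (T T' : ℝ → H) : Prop :=
  T 0 = T₀ ∧
  (∀ t : ℝ, 0 ≤ t → T t ∈ K) ∧
  (∀ b : ℝ, 0 < b → IntervalIntegrable T' MeasureTheory.volume 0 b) ∧
  (∀ a b : ℝ, 0 ≤ a → a ≤ b → T b - T a = ∫ t in a..b, T' t) ∧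
  (∀ᵐ t ∂(MeasureTheory.volume.restrict (Set.Ioi (0 : ℝ))),
    HasDerivAt T (T' t) t ∧ IsProjOn (tanCone K (T t)) (-(F' (T t))) (T' t))

/-- `f : ℝ → ℝ` is locally absolutely continuous on `[0,∞)` with a.e. derivative `g`
(encoded by the fundamental theorem of calculus with a locally integrable a.e.-derivative). -/
def IsLocACWithDeriv (f g : ℝ → ℝ) : Prop :=
  (∀ b : ℝ, 0 < b → IntervalIntegrable g MeasureTheory.volume 0 b) ∧
  (∀ a b : ℝ, 0 ≤ a → a ≤ b → f b - f a = ∫ t in a..b, g t) ∧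
  (∀ᵐ t ∂(MeasureTheory.volume.restrict (Set.Ioi (0 : ℝ))), HasDerivAt f (g t) t)

/-- `F` is `λ`-star-convex on `K` around `Tstar`. -/
def StarConvexAround (lam : ℝ) (K : Set H) (F : H → ℝ) (Tstar : H) : Prop :=
  ∀ T ∈ K, ∀ s : ℝ, 0 ≤ s → s ≤ 1 →
    F ((1 - s) • T + s • Tstar) ≤
      (1 - s) * F T + s * F Tstar - lam / 2 * s * (1 - s) * ‖T - Tstar‖ ^ 2


lemma tanCone_add_smul (K : Set H) (hK : Convex ℝ K) (x y w : H) (hy : y ∈ K)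
    (hw : w ∈ tanCone K x) (s : ℝ) (hs : 0 < s) : w + s • (y - x) ∈ tanCone K x := by
  unfold tanCone at *
  refine map_mem_closure (f := fun w => w + s • (y - x)) (by fun_prop) hw ?_
  rintro u ⟨t, ht, hu⟩
  have h1 : 0 < 1 + t * s := by positivity
  refine ⟨t / (1 + t * s), by positivity, ?_⟩
  have := hK hu hy (a := 1 / (1 + t * s)) (b := t * s / (1 + t * s)) (by positivity)
    (by positivity) (by field_simp)
  convert this using 1
  have e : (1 / (1 + t * s)) + t * s / (1 + t * s) = 1 := by field_simp
  have e2 : x = ((1 / (1 + t * s)) + t * s / (1 + t * s)) • x := by rw [e, one_smul]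
  nth_rewrite 1 [e2]
  module

lemma proj_inner_le (K : Set H) (hK : Convex ℝ K) (x y v w : H) (hy : y ∈ K)
    (hw : IsProjOn (tanCone K x) v w) : ⟪v - w, y - x⟫ ≤ 0 := by
  by_contra! hc
  set c := ⟪v - w, y - x⟫ with hcdef
  have key : ∀ s : ℝ, 0 < s → 2 * c ≤ s * ‖y - x‖ ^ 2 := by
    intro s hs
    have h := hw.2 _ (tanCone_add_smul K hK x y w hy hw.1 s hs)
    have h2 : ‖v - w‖ ^ 2 ≤ ‖v - w - s • (y - x)‖ ^ 2 := by
      rw [sub_sub]; gcongr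
    rw [norm_sub_sq_real (v - w), inner_smul_right, norm_smul, mul_pow, Real.norm_eq_abs,
      sq_abs, ← hcdef] at h2
    have : s * (2 * c) ≤ s * (s * ‖y - x‖ ^ 2) := by nlinarith
    exact le_of_mul_le_mul_left this hs
  have h := key (c / (‖y - x‖ ^ 2 + 1)) (by positivity)
  have : c / (‖y - x‖ ^ 2 + 1) * ‖y - x‖ ^ 2 ≤ c := by
    rw [div_mul_eq_mul_div, div_le_iff₀ (by positivity)]
    nlinarith
  linarith

lemma grad_inner_le (K : Set H) (F : H → ℝ) (g x y : H)
    (hg : HasGradientAt F g x) (hx : x ∈ K) (hmin : F y ≤ F x)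
    (hstar : StarConvexAround 0 K F y) : ⟪g, y - x⟫ ≤ 0 := by
  have h1 : HasDerivAt (fun s : ℝ => x + s • (y - x)) (y - x) 0 := by
    simpa using ((hasDerivAt_id (0 : ℝ)).smul_const (y - x)).const_add x
  have hF : HasFDerivAt F (InnerProductSpace.toDual ℝ H g) (x + (0 : ℝ) • (y - x)) := by
    simpa using hg.hasFDerivAt
  have h2 := hF.comp_hasDerivAt (0 : ℝ) h1
  have h3 := (hasDerivAt_iff_tendsto_slope.1 h2).mono_left
    (nhdsWithin_mono (0 : ℝ) (s := Set.Ioi 0) (fun z hz => ne_of_gt hz))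
  have h4 := le_of_tendsto (b := 0) h3 (by
    filter_upwards [Ioo_mem_nhdsGT (zero_lt_one' ℝ)] with s hs
    have h5 := hstar x hx s hs.1.le hs.2.le
    have e : x + s • (y - x) = (1 - s) • x + s • y := by module
    have h6 : F (x + s • (y - x)) ≤ F x := by
      rw [e]; nlinarith [hs.1]
    simp only [slope_def_field, Function.comp, zero_smul, add_zero, sub_zero]
    exact div_nonpos_of_nonpos_of_nonneg (by linarith) hs.1.le)
  simpa using h4

lemma ac_of_dist_le {f g : ℝ → ℝ} {a b : ℝ} (hg : AbsolutelyContinuousOnInterval g a b)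
    (h : ∀ x ∈ Set.uIcc a b, ∀ y ∈ Set.uIcc a b, dist (f x) (f y) ≤ dist (g x) (g y)) :
    AbsolutelyContinuousOnInterval f a b := by
  rw [absolutelyContinuousOnInterval_iff] at *
  intro ε hε
  obtain ⟨δ, hδ, H⟩ := hg ε hε
  refine ⟨δ, hδ, fun E hE hl => lt_of_le_of_lt ?_ (H E hE hl)⟩
  exact Finset.sum_le_sum fun i hi => h _ (hE.1 i hi).1 _ (hE.1 i hi).2

/-- Lyapunov monotonicity along the constrained gradient flow: if `Tstar` minimizes `F` over
`K` and `F` is star-convex on `K` around `Tstar`, then `t ↦ ‖T(t) − T*‖` is nonincreasing on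
`[0,∞)` along any solution of the constrained gradient flow. -/
theorem lyapunov_monotonicity (K : Set H) (hKne : K.Nonempty)
    (hKcl : IsClosed K) (hKconv : Convex ℝ K)
    (F : H → ℝ) (F' : H → H) (hgrad : ∀ x : H, HasGradientAt F (F' x) x)
    (Tstar : H) (hTstar : Tstar ∈ K) (hmin : ∀ U ∈ K, F Tstar ≤ F U)
    (hstar : StarConvexAround 0 K F Tstar)
    (T₀ : H) (hT₀ : T₀ ∈ K) (T T' : ℝ → H)
    (hflow : IsFlowSol K F' T₀ T T') :
    AntitoneOn (fun t => ‖T t - Tstar‖) (Set.Ici (0 : ℝ)) := by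
  obtain ⟨-, hK, hint, hftc, hae⟩ := hflow
  intro a ha b hb hab
  have ha : 0 ≤ a := ha
  have hb : 0 ≤ b := hb
  have hii : ∀ x y : ℝ, 0 ≤ x → 0 ≤ y → IntervalIntegrable T' volume x y := by
    have h0 : ∀ z : ℝ, 0 ≤ z → IntervalIntegrable T' volume 0 z := by
      intro z hz
      rcases hz.eq_or_lt with rfl | hz
      · exact IntervalIntegrable.refl
      · exact hint z hz
    exact fun x y hx hy => (h0 x hx).symm.trans (h0 y hy)
  have hnn : ∀ x ∈ Set.uIcc a b, 0 ≤ x := fun x hx => by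
    rw [Set.uIcc_of_le hab] at hx; exact ha.trans hx.1
  have hG := (hii a b ha hb).norm.absolutelyContinuousOnInterval_intervalIntegral
    (c := a) Set.left_mem_uIcc
  have hle : ∀ x y : ℝ, 0 ≤ x → x ≤ y →
      dist ‖T x - Tstar‖ ‖T y - Tstar‖ ≤
        dist (∫ t in a..x, ‖T' t‖) (∫ t in a..y, ‖T' t‖) := by
    intro x y hx hxy
    have hy := hx.trans hxy
    rw [dist_comm, dist_comm (∫ t in a..x, ‖T' t‖), Real.dist_eq, Real.dist_eq,
      intervalIntegral.integral_interval_sub_left (hii a y ha hy).norm (hii a x ha hx).norm]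
    calc |‖T y - Tstar‖ - ‖T x - Tstar‖| ≤ ‖(T y - Tstar) - (T x - Tstar)‖ :=
          abs_norm_sub_norm_le _ _
      _ = ‖∫ t in x..y, T' t‖ := by rw [sub_sub_sub_cancel_right, hftc x y hx hxy]
      _ ≤ ∫ t in x..y, ‖T' t‖ := intervalIntegral.norm_integral_le_integral_norm hxy
      _ ≤ _ := le_abs_self _
  have hf : AbsolutelyContinuousOnInterval (fun t => ‖T t - Tstar‖) a b := by
    refine ac_of_dist_le hG fun x hx y hy => ?_
    rcases le_total x y with hxy | hxy
    · exact hle x y (hnn x hx) hxy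
    · rw [dist_comm, dist_comm (∫ t in a..x, ‖T' t‖)]
      exact hle y x (hnn y hy) hxy
  have hI := (hf.mul hf).integral_deriv_eq_sub
  have hneg : ∫ t in a..b, deriv (fun t => ‖T t - Tstar‖ * ‖T t - Tstar‖) t ≤ 0 := by
    rw [intervalIntegral.integral_of_le hab]
    refine integral_nonpos_of_ae ?_
    have hsub : Set.Ioc a b ⊆ Set.Ioi (0 : ℝ) := fun x hx => lt_of_le_of_lt ha hx.1
    filter_upwards [ae_restrict_of_ae_restrict_of_subset hsub hae,
      ae_restrict_mem measurableSet_Ioc] with t ht htm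
    have ht0 : 0 ≤ t := ha.trans htm.1.le
    have hd : HasDerivAt (fun t => ‖T t - Tstar‖ * ‖T t - Tstar‖)
        (2 * ⟪T t - Tstar, T' t⟫) t := by
      simpa [pow_two] using (ht.1.sub_const Tstar).norm_sq
    rw [hd.deriv]
    have h1 := proj_inner_le K hKconv (T t) Tstar _ _ hTstar ht.2
    have h2 := grad_inner_le K F _ (T t) Tstar (hgrad (T t)) (hK t ht0) (hmin _ (hK t ht0)) hstar
    rw [inner_sub_left, inner_neg_left] at h1
    have h3 : ⟪T t - Tstar, T' t⟫ = -⟪T' t, Tstar - T t⟫ := by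
      rw [real_inner_comm, ← inner_neg_right, neg_sub]
    simp only [Pi.zero_apply]
    linarith
  have hfin : ‖T b - Tstar‖ * ‖T b - Tstar‖ ≤ ‖T a - Tstar‖ * ‖T a - Tstar‖ := by
    have hI' : ∫ t in a..b, deriv (fun t => ‖T t - Tstar‖ * ‖T t - Tstar‖) t =
      ‖T b - Tstar‖ * ‖T b - Tstar‖ - ‖T a - Tstar‖ * ‖T a - Tstar‖ := hI
    linarith
  exact (mul_self_le_mul_self_iff (norm_nonneg _) (norm_nonneg _)).2 hfin
end
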